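/- arXiv:2005.05951 — 2 statements merged into one kernel-verified Lean document; each statement's English description precedes it below -/
import Mathlib

section
/- (Coupling step in the proof of Theorem 1.) Let M be an MDP with rewards in [−Rmax, Rmax] and discount γ ∈ [0,1), let P̂ be an approximate kernel with α-unknown set U, let M̂_p be the (α, κ)-pessimistic MDP with initial distribution ρ̂0, and let M_p be the pessimistic MDP defined identically to M̂_p except that it has initial distribution ρ0 and from known pairs (s,a) transitions follow the true kernel P(·|s,a) instead of P̂(·|s,a). Then for any policy π: |J_{ρ̂0}(π, M̂_p) − J_{ρ0}(π, M_p)| ≤ (2·Rmax/(1−γ))·D_TV(ρ0, ρ̂0) + (2·γ·Rmax/(1−γ)²)·α. -/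
open scoped ENNReal NNReal
open Classical

namespace MOReL

universe u v

variable {S : Type u} {A : Type v}

/-- Distribution over trajectory prefixes `(s_0,a_0),…,(s_n,a_n)` generated by executing
policy `π` in the MDP with transition kernel `P` starting from `ρ0`. -/
noncomputable def pathPMF (ρ0 : PMF S) (π : S → PMF A) (P : S → A → PMF S) :
    (n : ℕ) → PMF (Fin (n + 1) → S × A)
  | 0 => ρ0.bind fun s => (π s).map fun a => fun _ => (s, a)
  | n + 1 =>
      (pathPMF ρ0 π P n).bind fun p =>
        (P (p (Fin.last n)).1 (p (Fin.last n)).2).bind fun s' =>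
          (π s').map fun a' => Fin.snoc p (s', a')

/-- Marginal distribution of `(s_t, a_t)`. -/
noncomputable def saDist (ρ0 : PMF S) (π : S → PMF A) (P : S → A → PMF S) (t : ℕ) :
    PMF (S × A) :=
  (pathPMF ρ0 π P t).map fun p => p (Fin.last t)

/-- Expectation of a real-valued function under a PMF. -/
noncomputable def pexp {α : Type*} (μ : PMF α) (f : α → ℝ) : ℝ :=
  ∑' x, (μ x).toReal * f x

/-- The value `J_{ρ0}(π, M) = E[∑_t γ^t r(s_t,a_t)]`. -/
noncomputable def J (ρ0 : PMF S) (π : S → PMF A) (P : S → A → PMF S) (γ : ℝ)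
    (r : S → A → ℝ) : ℝ :=
  ∑' t : ℕ, γ ^ t * pexp (saDist ρ0 π P t) (fun sa => r sa.1 sa.2)

/-- `P(T_V^π = t)`: the probability that the first visit of the executed trajectory to the
state-action set `V` occurs at time `t`. -/
noncomputable def hitProb (ρ0 : PMF S) (π : S → PMF A) (P : S → A → PMF S)
    (V : Set (S × A)) (t : ℕ) : ℝ≥0∞ :=
  (pathPMF ρ0 π P t).toOuterMeasure
    {p | p (Fin.last t) ∈ V ∧ ∀ i : Fin (t + 1), (i : ℕ) < t → p i ∉ V}

/-- `E[γ^{T_V^π}]`, with the convention `γ^∞ = 0`. -/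
noncomputable def discHit (ρ0 : PMF S) (π : S → PMF A) (P : S → A → PMF S) (γ : ℝ)
    (V : Set (S × A)) : ℝ :=
  ∑' t : ℕ, γ ^ t * (hitProb ρ0 π P V t).toReal

/-- Total variation distance between two PMFs. -/
noncomputable def DTV {α : Type*} (p q : PMF α) : ℝ :=
  (1 / 2) * ∑' x, |(p x).toReal - (q x).toReal|

/-- Discounted state-action visitation distribution `d^{π,M}(s,a)`. -/
noncomputable def dVisit (ρ0 : PMF S) (π : S → PMF A) (P : S → A → PMF S) (γ : ℝ)
    (sa : S × A) : ℝ :=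
  (1 - γ) * ∑' t : ℕ, γ ^ t * ((saDist ρ0 π P t) sa).toReal

/-- `d^{π,M}(V)` for a set `V` of state-action pairs. -/
noncomputable def dVisitSet (ρ0 : PMF S) (π : S → PMF A) (P : S → A → PMF S) (γ : ℝ)
    (V : Set (S × A)) : ℝ :=
  ∑' sa : V, dVisit ρ0 π P γ sa

/-- The set of `α`-unknown state-action pairs. -/
def unknown (P Phat : S → A → PMF S) (α : ℝ) : Set (S × A) :=
  {sa | α < DTV (Phat sa.1 sa.2) (P sa.1 sa.2)}

/-- Transition kernel of the pessimistic MDP on `Option S` (`none` is the absorbing state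
HALT): unknown pairs and HALT transition to HALT, known pairs follow `Phat`. -/
noncomputable def pessKernel (Phat : S → A → PMF S) (U : Set (S × A)) :
    Option S → A → PMF (Option S) := fun s a =>
  match s with
  | none => PMF.pure none
  | some s => if (s, a) ∈ U then PMF.pure none else (Phat s a).map some

/-- Reward of the pessimistic MDP: `-κ` at HALT and `r` elsewhere. -/
def pessReward (r : S → A → ℝ) (κ : ℝ) : Option S → A → ℝ := fun s a =>
  match s with
  | none => -κ
  | some s => r s a

/-- Extend a policy on `S` to `Option S` by an arbitrary action distribution at HALT
(the pessimistic value does not depend on this choice). -/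
def extendPolicy (π : S → PMF A) (a0 : PMF A) : Option S → PMF A := fun s =>
  match s with
  | none => a0
  | some s => π s

end MOReL

namespace MOReL

/-- The `ℓ¹` distance between two PMFs, as an extended nonnegative real. -/
noncomputable def l1EDist {X : Type*} (p q : PMF X) : ℝ≥0∞ :=
  ∑' x, ‖(p x).toReal - (q x).toReal‖ₑ

lemma summable_pmf_toReal {X : Type*} (p : PMF X) : Summable fun x => (p x).toReal :=
  ENNReal.summable_toReal p.tsum_coe_ne_top

lemma tsum_pmf_toReal {X : Type*} (p : PMF X) : ∑' x, (p x).toReal = 1 := by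
  rw [← ENNReal.tsum_toReal_eq p.apply_ne_top, p.tsum_coe, ENNReal.toReal_one]

lemma enorm_pmf_toReal {X : Type*} (p : PMF X) (x : X) : ‖(p x).toReal‖ₑ = p x := by
  rw [Real.enorm_eq_ofReal ENNReal.toReal_nonneg, ENNReal.ofReal_toReal (p.apply_ne_top x)]

lemma summable_abs_sub_pmf {X : Type*} (p q : PMF X) :
    Summable fun x => |(p x).toReal - (q x).toReal| :=
  ((summable_pmf_toReal p).sub (summable_pmf_toReal q)).abs

lemma l1EDist_eq_ofReal {X : Type*} (p q : PMF X) :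
    l1EDist p q = ENNReal.ofReal (2 * DTV p q) := by
  have h : 2 * DTV p q = ∑' x, |(p x).toReal - (q x).toReal| := by
    unfold DTV; ring
  rw [h, ENNReal.ofReal_tsum_of_nonneg (fun _ => abs_nonneg _) (summable_abs_sub_pmf p q)]
  simp only [l1EDist, Real.enorm_eq_ofReal_abs]

lemma DTV_nonneg {X : Type*} (p q : PMF X) : 0 ≤ DTV p q :=
  mul_nonneg (by norm_num) (tsum_nonneg fun _ => abs_nonneg _)

lemma DTV_comm {X : Type*} (p q : PMF X) : DTV p q = DTV q p := by
  simp only [DTV, abs_sub_comm]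

@[simp] lemma DTV_self {X : Type*} (p : PMF X) : DTV p p = 0 := by
  simp [DTV]

lemma bind_apply_toReal {X Y : Type*} (p : PMF X) (f : X → PMF Y) (y : Y) :
    ((p.bind f) y).toReal = ∑' x, (p x).toReal * (f x y).toReal := by
  rw [PMF.bind_apply, ENNReal.tsum_toReal_eq]
  · simp only [ENNReal.toReal_mul]
  · exact fun x => ENNReal.mul_ne_top (p.apply_ne_top x) ((f x).apply_ne_top y)

lemma summable_bind_toReal {X Y : Type*} (p : PMF X) (f : X → PMF Y) (y : Y) :
    Summable fun x => (p x).toReal * (f x y).toReal := by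
  simp only [← ENNReal.toReal_mul]
  apply ENNReal.summable_toReal
  rw [← PMF.bind_apply]
  exact (p.bind f).apply_ne_top y

lemma l1EDist_bind_le {X Y : Type*} (p q : PMF X) (f g : X → PMF Y) {c : ℝ≥0∞}
    (h : ∀ x, l1EDist (f x) (g x) ≤ c) :
    l1EDist (p.bind f) (q.bind g) ≤ l1EDist p q + c := by
  have hpt (y : Y) : ‖((p.bind f) y).toReal - ((q.bind g) y).toReal‖ₑ ≤
      ∑' x, (‖(p x).toReal - (q x).toReal‖ₑ * f x y +
        q x * ‖(f x y).toReal - (g x y).toReal‖ₑ) := by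
    rw [bind_apply_toReal, bind_apply_toReal,
      ← (summable_bind_toReal p f y).tsum_sub (summable_bind_toReal q g y)]
    refine enorm_tsum_le_tsum_enorm.trans (ENNReal.tsum_le_tsum fun x => ?_)
    have hx : (p x).toReal * (f x y).toReal - (q x).toReal * (g x y).toReal =
        ((p x).toReal - (q x).toReal) * (f x y).toReal +
          (q x).toReal * ((f x y).toReal - (g x y).toReal) := by ring
    rw [hx]
    refine (enorm_add_le _ _).trans_eq ?_
    rw [enorm_mul, enorm_mul, enorm_pmf_toReal, enorm_pmf_toReal]
  calc l1EDist (p.bind f) (q.bind g)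
      ≤ ∑' y, ∑' x, (‖(p x).toReal - (q x).toReal‖ₑ * f x y +
          q x * ‖(f x y).toReal - (g x y).toReal‖ₑ) := ENNReal.tsum_le_tsum hpt
    _ = ∑' x, (‖(p x).toReal - (q x).toReal‖ₑ + q x * l1EDist (f x) (g x)) := by
        rw [ENNReal.tsum_comm]
        simp only [ENNReal.tsum_add, ENNReal.tsum_mul_left, PMF.tsum_coe, mul_one, l1EDist]
    _ ≤ ∑' x, (‖(p x).toReal - (q x).toReal‖ₑ + q x * c) := by
        gcongr with x
        exact h x
    _ = l1EDist p q + c := by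
        rw [ENNReal.tsum_add, ENNReal.tsum_mul_right, PMF.tsum_coe, one_mul, l1EDist]

lemma DTV_bind_le {X Y : Type*} (p q : PMF X) (f g : X → PMF Y) {c : ℝ}
    (hc : 0 ≤ c) (h : ∀ x, DTV (f x) (g x) ≤ c) :
    DTV (p.bind f) (q.bind g) ≤ DTV p q + c := by
  have hpq := DTV_nonneg p q
  have key := l1EDist_bind_le p q f g (c := ENNReal.ofReal (2 * c)) fun x => by
    rw [l1EDist_eq_ofReal]
    exact ENNReal.ofReal_le_ofReal (by linarith [h x])
  rw [l1EDist_eq_ofReal, l1EDist_eq_ofReal, ← ENNReal.ofReal_add (by positivity) (by positivity),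
    ENNReal.ofReal_le_ofReal_iff (by positivity)] at key
  linarith

lemma DTV_bind_right_le {X Y : Type*} (p q : PMF X) (f : X → PMF Y) :
    DTV (p.bind f) (q.bind f) ≤ DTV p q := by
  simpa using DTV_bind_le p q f f le_rfl fun x => (DTV_self (f x)).le

lemma DTV_map_le {X Y : Type*} (p q : PMF X) (f : X → Y) :
    DTV (p.map f) (q.map f) ≤ DTV p q :=
  DTV_bind_right_le p q (PMF.pure ∘ f)

lemma abs_pexp_sub_le {X : Type*} (p q : PMF X) {f : X → ℝ} {R : ℝ} (hf : ∀ x, |f x| ≤ R) :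
    |pexp p f - pexp q f| ≤ 2 * R * DTV p q := by
  have hsum (μ : PMF X) : Summable fun x => (μ x).toReal * f x :=
    .of_norm_bounded ((summable_pmf_toReal μ).mul_right R) fun x => by
      rw [norm_mul, Real.norm_of_nonneg ENNReal.toReal_nonneg, Real.norm_eq_abs]
      exact mul_le_mul_of_nonneg_left (hf x) ENNReal.toReal_nonneg
  rw [pexp, pexp, ← (hsum p).tsum_sub (hsum q), ← Real.norm_eq_abs]
  have hD : HasSum (fun x => |(p x).toReal - (q x).toReal| * R) (2 * R * DTV p q) := by
    convert! (summable_abs_sub_pmf p q).hasSum.mul_right R using 1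
    unfold DTV; ring
  refine tsum_of_norm_bounded hD fun x => ?_
  rw [← sub_mul, norm_mul, Real.norm_eq_abs, Real.norm_eq_abs]
  exact mul_le_mul_of_nonneg_left (hf x) (abs_nonneg _)

lemma abs_pexp_le {X : Type*} (p : PMF X) {f : X → ℝ} {R : ℝ} (hf : ∀ x, |f x| ≤ R) :
    |pexp p f| ≤ R := by
  have hs : HasSum (fun x => (p x).toReal * R) R := by
    simpa [tsum_pmf_toReal] using (summable_pmf_toReal p).hasSum.mul_right R
  rw [← Real.norm_eq_abs]
  refine tsum_of_norm_bounded hs fun x => ?_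
  rw [norm_mul, Real.norm_of_nonneg ENNReal.toReal_nonneg, Real.norm_eq_abs]
  exact mul_le_mul_of_nonneg_left (hf x) ENNReal.toReal_nonneg

lemma saDist_zero {S A : Type*} (ρ : PMF S) (π : S → PMF A) (P : S → A → PMF S) :
    saDist ρ π P 0 = ρ.bind fun s => (π s).map fun a => (s, a) := by
  simp only [saDist, pathPMF, PMF.map_bind, PMF.map_comp, Function.comp_def]

lemma saDist_succ {S A : Type*} (ρ : PMF S) (π : S → PMF A) (P : S → A → PMF S) (t : ℕ) :
    saDist ρ π P (t + 1) = (saDist ρ π P t).bind fun sa =>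
      (P sa.1 sa.2).bind fun s' => (π s').map fun a' => (s', a') := by
  simp only [saDist, pathPMF, PMF.map_bind, PMF.bind_map, PMF.map_comp, Function.comp_def,
    Fin.snoc_last]

lemma DTV_saDist_le {S A : Type*} (ρ ρ' : PMF S) (π : S → PMF A) (P P' : S → A → PMF S)
    {α : ℝ} (hα : 0 ≤ α) (h : ∀ s a, DTV (P s a) (P' s a) ≤ α) (t : ℕ) :
    DTV (saDist ρ π P t) (saDist ρ' π P' t) ≤ DTV ρ ρ' + t * α := by
  induction t with
  | zero =>
    rw [saDist_zero, saDist_zero]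
    simpa using DTV_bind_right_le ρ ρ' _
  | succ t ih =>
    rw [saDist_succ, saDist_succ]
    have := DTV_bind_le (saDist ρ π P t) (saDist ρ' π P' t)
      (fun sa => (P sa.1 sa.2).bind fun s' => (π s').map fun a' => (s', a'))
      (fun sa => (P' sa.1 sa.2).bind fun s' => (π s').map fun a' => (s', a')) hα
      fun sa => (DTV_bind_right_le _ _ _).trans (h sa.1 sa.2)
    push_cast
    linarith

/-- Simulation lemma: the values of a policy in two MDPs with the same bounded reward, initial
distributions `ρ`, `ρ'`, and kernels uniformly `α`-close in total variation. -/
lemma abs_J_sub_le {S A : Type*} (ρ ρ' : PMF S) (π : S → PMF A) (P P' : S → A → PMF S)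
    {r : S → A → ℝ} {R α γ : ℝ} (hr : ∀ s a, |r s a| ≤ R) (hR : 0 ≤ R) (hα : 0 ≤ α)
    (hγ0 : 0 ≤ γ) (hγ1 : γ < 1) (h : ∀ s a, DTV (P s a) (P' s a) ≤ α) :
    |J ρ π P γ r - J ρ' π P' γ r| ≤
      (2 * R / (1 - γ)) * DTV ρ ρ' + (2 * γ * R / (1 - γ) ^ 2) * α := by
  have hgeo := hasSum_geometric_of_lt_one hγ0 hγ1
  have hsum (ρ : PMF S) (P : S → A → PMF S) :
      Summable fun t : ℕ => γ ^ t * pexp (saDist ρ π P t) (fun sa => r sa.1 sa.2) :=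
    .of_norm_bounded (hgeo.summable.mul_right R) fun t => by
      rw [norm_mul, Real.norm_of_nonneg (pow_nonneg hγ0 t), Real.norm_eq_abs]
      exact mul_le_mul_of_nonneg_left (abs_pexp_le _ fun sa => hr sa.1 sa.2) (pow_nonneg hγ0 t)
  have hlin : HasSum (fun t : ℕ => (t : ℝ) * γ ^ t) (γ / (1 - γ) ^ 2) :=
    hasSum_coe_mul_geometric_of_norm_lt_one (by rwa [Real.norm_of_nonneg hγ0])
  have hbound : HasSum (fun t : ℕ => γ ^ t * (2 * R * (DTV ρ ρ' + t * α)))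
      ((2 * R / (1 - γ)) * DTV ρ ρ' + (2 * γ * R / (1 - γ) ^ 2) * α) := by
    convert! (hgeo.mul_left (2 * R * DTV ρ ρ')).add (hlin.mul_left (2 * R * α)) using 1
    · ext t; ring
    · ring
  rw [J, J, ← (hsum ρ P).tsum_sub (hsum ρ' P'), ← Real.norm_eq_abs]
  refine tsum_of_norm_bounded hbound fun t => ?_
  rw [← mul_sub, norm_mul, Real.norm_of_nonneg (pow_nonneg hγ0 t), Real.norm_eq_abs]
  refine mul_le_mul_of_nonneg_left ?_ (pow_nonneg hγ0 t)
  refine (abs_pexp_sub_le _ _ fun sa : S × A => hr sa.1 sa.2).trans ?_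
  exact mul_le_mul_of_nonneg_left (DTV_saDist_le ρ ρ' π P P' hα h t) (by positivity)

lemma DTV_pessKernel_le {S A : Type*} (P Phat : S → A → PMF S) {α : ℝ} (hα : 0 ≤ α)
    (s : Option S) (a : A) :
    DTV (pessKernel Phat (unknown P Phat α) s a) (pessKernel P (unknown P Phat α) s a) ≤ α := by
  cases s with
  | none => simpa [pessKernel] using hα
  | some s =>
    by_cases hs : (s, a) ∈ unknown P Phat α
    · simpa [pessKernel, hs] using hα
    · simp only [pessKernel, hs, if_false]
      exact (DTV_map_le _ _ some).trans (not_lt.mp hs)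

/-- **Coupling step in the proof of Theorem 1.** The values of a policy in the model-based
pessimistic MDP (kernel `Phat` on known pairs, initial distribution `ρhat`) and in the
true-dynamics pessimistic MDP (kernel `P` on known pairs, initial distribution `ρ0`)
differ by at most the stated coupling error. -/
theorem pessimistic_coupling
    {S : Type u} {A : Type v} [Countable S] [Countable A]
    (P Phat : S → A → PMF S) (ρ0 ρhat : PMF S)
    (r : S → A → ℝ) (Rmax : ℝ) (hR : ∀ s a, |r s a| ≤ Rmax)
    (κ : ℝ) (hκ : |κ| ≤ Rmax)
    (γ : ℝ) (hγ0 : 0 ≤ γ) (hγ1 : γ < 1)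
    (α : ℝ) (hα : 0 ≤ α)
    (π : S → PMF A) (a0 : PMF A) :
    |J (ρhat.map some) (extendPolicy π a0)
        (pessKernel Phat (unknown P Phat α)) γ (pessReward r κ)
      - J (ρ0.map some) (extendPolicy π a0)
          (pessKernel P (unknown P Phat α)) γ (pessReward r κ)|
      ≤ (2 * Rmax / (1 - γ)) * DTV ρ0 ρhat
        + (2 * γ * Rmax / (1 - γ) ^ 2) * α := by
  have hr (s : Option S) (a : A) : |pessReward r κ s a| ≤ Rmax := by
    cases s with
    | none => simpa [pessReward] using hκ
    | some s => exact hR s a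
  have hRmax : 0 ≤ Rmax := (abs_nonneg κ).trans hκ
  refine (abs_J_sub_le (ρhat.map some) (ρ0.map some) (extendPolicy π a0) _ _ hr hRmax hα hγ0 hγ1
    (DTV_pessKernel_le P Phat hα)).trans ?_
  have hγ : 0 ≤ 1 - γ := (sub_pos.mpr hγ1).le
  gcongr
  exact (DTV_map_le ρhat ρ0 some).trans_eq (DTV_comm ρhat ρ0)

end MOReL
end

section
/- (Comparison against an arbitrary policy; combined chain inequality from the proof of Lemma 1.) Let M be an MDP with rewards in [−Rmax, Rmax] and discount γ ∈ [0,1), let M̂_p be the (α, Rmax)-pessimistic MDP built from an approximate kernel P̂, its α-unknown set U, and estimated initial distribution ρ̂0, and let π_out be ε_π-suboptimal for M̂_p. Then for every policy π: J_{ρ0}(π_out, M) ≥ J_{ρ0}(π, M) − ε_π − (4·Rmax/(1−γ))·D_TV(ρ0, ρ̂0) − (4·γ·Rmax/(1−γ)²)·α − (2·Rmax/(1−γ))·E[γ^{T_U^π}]. -/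
open scoped ENNReal NNReal
open Classical

namespace MOReL

section Expectation

variable {X Y : Type*}

lemma pmf_summable_toReal (μ : PMF X) : Summable fun x => (μ x).toReal :=
  ENNReal.summable_toReal μ.tsum_coe_ne_top

lemma pmf_tsum_toReal (μ : PMF X) : ∑' x, (μ x).toReal = 1 := by
  rw [← ENNReal.tsum_toReal_eq (fun x => μ.apply_ne_top x), μ.tsum_coe, ENNReal.toReal_one]

lemma pexp_summable (μ : PMF X) {f : X → ℝ} {C : ℝ} (hf : ∀ x, |f x| ≤ C) :
    Summable fun x => (μ x).toReal * f x := by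
  refine Summable.of_norm_bounded ((pmf_summable_toReal μ).mul_right C) fun x => ?_
  rw [Real.norm_eq_abs, abs_mul, abs_of_nonneg ENNReal.toReal_nonneg]
  exact mul_le_mul_of_nonneg_left (hf x) ENNReal.toReal_nonneg

lemma pexp_const (μ : PMF X) (c : ℝ) : pexp μ (fun _ => c) = c := by
  rw [pexp, tsum_mul_right, pmf_tsum_toReal, one_mul]

lemma pexp_mono (μ : PMF X) {f g : X → ℝ} {C C' : ℝ} (hf : ∀ x, |f x| ≤ C)
    (hg : ∀ x, |g x| ≤ C') (hfg : ∀ x, f x ≤ g x) : pexp μ f ≤ pexp μ g :=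
  (pexp_summable μ hf).tsum_le_tsum
    (fun x => mul_le_mul_of_nonneg_left (hfg x) ENNReal.toReal_nonneg) (pexp_summable μ hg)

lemma pexp_abs_le (μ : PMF X) {f : X → ℝ} {C : ℝ} (hf : ∀ x, |f x| ≤ C) :
    |pexp μ f| ≤ C := by
  have hC : ∀ x : X, |(fun _ => C) x| ≤ |C| := fun _ => le_rfl
  have hC' : ∀ x : X, |(fun _ => -C) x| ≤ |C| := fun _ => (abs_neg C).le
  rw [abs_le]
  refine ⟨?_, ?_⟩
  · rw [← pexp_const μ (-C)]
    exact pexp_mono μ hC' hf fun x => (abs_le.1 (hf x)).1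
  · rw [← pexp_const μ C]
    exact pexp_mono μ hf hC fun x => (abs_le.1 (hf x)).2

lemma pexp_const_mul (μ : PMF X) (c : ℝ) (f : X → ℝ) :
    pexp μ (fun x => c * f x) = c * pexp μ f := by
  simp only [pexp, mul_left_comm _ c, tsum_mul_left]

lemma pexp_sub (μ : PMF X) {f g : X → ℝ} {C C' : ℝ} (hf : ∀ x, |f x| ≤ C)
    (hg : ∀ x, |g x| ≤ C') : pexp μ (fun x => f x - g x) = pexp μ f - pexp μ g := by
  simp only [pexp, mul_sub]
  exact (pexp_summable μ hf).tsum_sub (pexp_summable μ hg)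

lemma pexp_pure (x : X) (f : X → ℝ) : pexp (PMF.pure x) f = f x := by
  rw [pexp, tsum_eq_single x]
  · simp
  · intro y hy
    simp [PMF.pure_apply, hy]

lemma pexp_bind (μ : PMF X) (κ : X → PMF Y) {f : Y → ℝ} {C : ℝ} (hf : ∀ y, |f y| ≤ C) :
    pexp (μ.bind κ) f = pexp μ fun x => pexp (κ x) f := by
  have hnn : ∀ p : X × Y, 0 ≤ (μ p.1).toReal * (κ p.1 p.2).toReal := fun p =>
    mul_nonneg ENNReal.toReal_nonneg ENNReal.toReal_nonneg
  have hprod : Summable fun p : X × Y => (μ p.1).toReal * (κ p.1 p.2).toReal := by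
    rw [summable_prod_of_nonneg hnn]
    constructor
    · intro x
      exact (pmf_summable_toReal (κ x)).mul_left (μ x).toReal
    · simp only [tsum_mul_left, pmf_tsum_toReal, mul_one]
      exact pmf_summable_toReal μ
  have hsum : Summable fun p : X × Y => (μ p.1).toReal * ((κ p.1 p.2).toReal * f p.2) := by
    refine Summable.of_norm_bounded (hprod.mul_right C) fun p => ?_
    rw [← mul_assoc, Real.norm_eq_abs, abs_mul, abs_of_nonneg (hnn p)]
    exact mul_le_mul_of_nonneg_left (hf p.2) (hnn p)
  simp only [pexp, ← tsum_mul_left]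
  rw [← Summable.tsum_comm (f := fun x y => (μ x).toReal * ((κ x y).toReal * f y)) hsum]
  refine tsum_congr fun y => ?_
  rw [PMF.bind_apply, ENNReal.tsum_toReal_eq, ← tsum_mul_right]
  · simp only [ENNReal.toReal_mul, mul_assoc]
  · exact fun x => ENNReal.mul_ne_top (μ.apply_ne_top x) ((κ x).apply_ne_top y)

lemma pexp_map (μ : PMF X) (g : X → Y) {f : Y → ℝ} {C : ℝ} (hf : ∀ y, |f y| ≤ C) :
    pexp (μ.map g) f = pexp μ fun x => f (g x) := by
  rw [← PMF.bind_pure_comp, pexp_bind μ _ hf]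
  simp only [Function.comp_apply, pexp_pure]

lemma pexp_tsum (μ : PMF X) {g : ℕ → X → ℝ} {b : ℕ → ℝ} (hb : Summable b)
    (hg : ∀ t x, |g t x| ≤ b t) :
    pexp μ (fun x => ∑' t, g t x) = ∑' t, pexp μ (g t) := by
  have hdom : Summable fun p : X × ℕ => (μ p.1).toReal * b p.2 :=
    (pmf_summable_toReal μ).mul_of_nonneg hb (fun _ => ENNReal.toReal_nonneg)
      (fun t => (abs_nonneg _).trans (hg t (μ.support_nonempty.some)))
  have hsum : Summable fun p : X × ℕ => (μ p.1).toReal * g p.2 p.1 := by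
    refine Summable.of_norm_bounded hdom fun p => ?_
    rw [Real.norm_eq_abs, abs_mul, abs_of_nonneg ENNReal.toReal_nonneg]
    exact mul_le_mul_of_nonneg_left (hg _ _) ENNReal.toReal_nonneg
  simp only [pexp, ← tsum_mul_left]
  exact (Summable.tsum_comm (f := fun x t => (μ x).toReal * g t x) hsum).symm

lemma pexp_indicator_one (μ : PMF X) (B : Set X) :
    pexp μ (B.indicator 1) = (μ.toOuterMeasure B).toReal := by
  rw [PMF.toOuterMeasure_apply, ENNReal.tsum_toReal_eq, pexp]
  · refine tsum_congr fun x => ?_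
    by_cases hx : x ∈ B <;> simp [hx]
  · intro x
    by_cases hx : x ∈ B <;> simp [hx, μ.apply_ne_top]

/-- Changing the distribution moves the expectation of a bounded function by at most twice
the bound times the total variation distance. -/
lemma abs_pexp_sub_pexp_le (p q : PMF X) {f : X → ℝ} {C : ℝ} (hf : ∀ x, |f x| ≤ C) :
    |pexp p f - pexp q f| ≤ 2 * C * DTV p q := by
  have hs : Summable fun x => |(p x).toReal - (q x).toReal| :=
    ((pmf_summable_toReal p).sub (pmf_summable_toReal q)).abs
  rw [pexp, pexp, ← (pexp_summable p hf).tsum_sub (pexp_summable q hf)]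
  have hle := tsum_of_norm_bounded (hs.mul_right C).hasSum
    (f := fun x => (p x).toReal * f x - (q x).toReal * f x) (fun x => by
      rw [← sub_mul, Real.norm_eq_abs, abs_mul]
      exact mul_le_mul_of_nonneg_left (hf x) (abs_nonneg _))
  rw [tsum_mul_right, Real.norm_eq_abs] at hle
  rw [DTV]
  linarith

end Expectation

/-- A bounded function satisfying a `γ`-contractive one-step bound with offset `c` is at most
`c / (1 - γ)`. -/
lemma le_div_of_contraction {X : Type*} {D : X → ℝ} {C γ c : ℝ} (hD : ∀ x, |D x| ≤ C)
    (hγ0 : 0 ≤ γ) (hγ1 : γ < 1) (hc : 0 ≤ c)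
    (hstep : ∀ m, 0 ≤ m → (∀ x, D x ≤ m) → ∀ x, D x ≤ γ * m + c) (x : X) :
    D x ≤ c / (1 - γ) := by
  have hbdd : BddAbove (Set.range D) :=
    ⟨C, by rintro _ ⟨y, rfl⟩; exact (le_abs_self _).trans (hD y)⟩
  have : Nonempty X := ⟨x⟩
  set m := max (⨆ y, D y) 0 with hm
  have hm0 : 0 ≤ m := le_max_right _ _
  have hDm : ∀ y, D y ≤ m := fun y => (le_ciSup hbdd y).trans (le_max_left _ _)
  have hle : m ≤ γ * m + c :=
    max_le (ciSup_le (hstep m hm0 hDm)) (add_nonneg (mul_nonneg hγ0 hm0) hc)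
  refine (hDm x).trans ?_
  rw [le_div_iff₀ (by linarith)]
  linarith

section Bellman

variable {S : Type*} {A : Type*}

/-- Expectation of `f` over the state-action pair obtained by drawing a state from `ρ` and an
action from `π`. -/
noncomputable def policyExp (ρ : PMF S) (π : S → PMF A) (f : S × A → ℝ) : ℝ :=
  pexp ρ fun s => pexp (π s) fun a => f (s, a)

/-- One step of the policy-evaluation operator, killed on `V`. -/
noncomputable def killedStep (π : S → PMF A) (P : S → A → PMF S) (V : Set (S × A))
    (f : S × A → ℝ) : S × A → ℝ :=
  Vᶜ.indicator fun x => policyExp (P x.1 x.2) π f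

/-- Discounted sum of `f` collected up to the first visit to `V` inclusive, as a function of
the initial state-action pair. -/
noncomputable def killedValue (π : S → PMF A) (P : S → A → PMF S) (V : Set (S × A)) (γ : ℝ)
    (f : S × A → ℝ) (x : S × A) : ℝ :=
  ∑' t : ℕ, γ ^ t * (killedStep π P V)^[t] f x

lemma policyExp_abs_le (ρ : PMF S) (π : S → PMF A) {f : S × A → ℝ} {C : ℝ}
    (hf : ∀ x, |f x| ≤ C) : |policyExp ρ π f| ≤ C :=
  pexp_abs_le _ fun s => pexp_abs_le _ fun a => hf (s, a)

lemma policyExp_mono (ρ : PMF S) (π : S → PMF A) {f g : S × A → ℝ} {C C' : ℝ}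
    (hf : ∀ x, |f x| ≤ C) (hg : ∀ x, |g x| ≤ C') (hfg : ∀ x, f x ≤ g x) :
    policyExp ρ π f ≤ policyExp ρ π g :=
  pexp_mono _ (fun s => pexp_abs_le _ fun a => hf (s, a))
    (fun s => pexp_abs_le _ fun a => hg (s, a))
    fun s => pexp_mono _ (fun a => hf (s, a)) (fun a => hg (s, a)) fun a => hfg (s, a)

lemma policyExp_const (ρ : PMF S) (π : S → PMF A) (c : ℝ) :
    policyExp ρ π (fun _ => c) = c := by
  simp only [policyExp, pexp_const]

lemma policyExp_le (ρ : PMF S) (π : S → PMF A) {f : S × A → ℝ} {C m : ℝ}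
    (hf : ∀ x, |f x| ≤ C) (hm : ∀ x, f x ≤ m) : policyExp ρ π f ≤ m := by
  rw [← policyExp_const ρ π m]
  exact policyExp_mono ρ π hf (fun _ => le_refl |m|) hm

lemma policyExp_const_mul (ρ : PMF S) (π : S → PMF A) (c : ℝ) (f : S × A → ℝ) :
    policyExp ρ π (fun x => c * f x) = c * policyExp ρ π f := by
  simp only [policyExp, pexp_const_mul]

lemma policyExp_sub (ρ : PMF S) (π : S → PMF A) {f g : S × A → ℝ} {C C' : ℝ}
    (hf : ∀ x, |f x| ≤ C) (hg : ∀ x, |g x| ≤ C') :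
    policyExp ρ π (fun x => f x - g x) = policyExp ρ π f - policyExp ρ π g := by
  rw [policyExp, policyExp, policyExp, ← pexp_sub ρ (fun s => pexp_abs_le _ fun a => hf (s, a))
    (fun s => pexp_abs_le _ fun a => hg (s, a))]
  congr 1
  funext s
  exact pexp_sub _ (fun a => hf (s, a)) (fun a => hg (s, a))

lemma policyExp_tsum (ρ : PMF S) (π : S → PMF A) {g : ℕ → S × A → ℝ} {b : ℕ → ℝ}
    (hb : Summable b) (hg : ∀ t x, |g t x| ≤ b t) :
    policyExp ρ π (fun x => ∑' t, g t x) = ∑' t, policyExp ρ π (g t) := by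
  simp only [policyExp]
  rw [← pexp_tsum ρ hb fun t s => pexp_abs_le _ fun a => hg t (s, a)]
  congr 1
  funext s
  exact pexp_tsum _ hb fun t a => hg t (s, a)

lemma abs_policyExp_sub_le (ρ ρ' : PMF S) (π : S → PMF A) {f : S × A → ℝ} {C : ℝ}
    (hf : ∀ x, |f x| ≤ C) :
    |policyExp ρ π f - policyExp ρ' π f| ≤ 2 * C * DTV ρ ρ' :=
  abs_pexp_sub_pexp_le ρ ρ' fun s => pexp_abs_le _ fun a => hf (s, a)

lemma killedStep_abs_le (π : S → PMF A) (P : S → A → PMF S) (V : Set (S × A))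
    {f : S × A → ℝ} {C : ℝ} (hf : ∀ x, |f x| ≤ C) (x : S × A) :
    |killedStep π P V f x| ≤ C := by
  rw [killedStep]
  by_cases hx : x ∈ Vᶜ
  · rw [Set.indicator_of_mem hx]
    exact policyExp_abs_le _ _ hf
  · rw [Set.indicator_of_notMem hx, abs_zero]
    exact (abs_nonneg _).trans (hf x)

lemma killedStep_iterate_abs_le (π : S → PMF A) (P : S → A → PMF S) (V : Set (S × A))
    {f : S × A → ℝ} {C : ℝ} (hf : ∀ x, |f x| ≤ C) (t : ℕ) (x : S × A) :
    |(killedStep π P V)^[t] f x| ≤ C := by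
  induction t generalizing x with
  | zero => exact hf x
  | succ t ih =>
    rw [Function.iterate_succ_apply']
    exact killedStep_abs_le π P V ih x

lemma discounted_abs_le {γ : ℝ} (hγ0 : 0 ≤ γ) (π : S → PMF A) (P : S → A → PMF S)
    (V : Set (S × A)) {f : S × A → ℝ} {C : ℝ} (hf : ∀ x, |f x| ≤ C) (t : ℕ) (x : S × A) :
    |γ ^ t * (killedStep π P V)^[t] f x| ≤ γ ^ t * C := by
  rw [abs_mul, abs_of_nonneg (pow_nonneg hγ0 t)]
  exact mul_le_mul_of_nonneg_left (killedStep_iterate_abs_le π P V hf t x) (pow_nonneg hγ0 t)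

lemma killedValue_abs_le {γ : ℝ} (hγ0 : 0 ≤ γ) (hγ1 : γ < 1) (π : S → PMF A)
    (P : S → A → PMF S) (V : Set (S × A)) {f : S × A → ℝ} {C : ℝ} (hf : ∀ x, |f x| ≤ C)
    (x : S × A) : |killedValue π P V γ f x| ≤ C / (1 - γ) := by
  have h := tsum_of_norm_bounded ((hasSum_geometric_of_lt_one hγ0 hγ1).mul_right C)
    (f := fun t => γ ^ t * (killedStep π P V)^[t] f x)
    (fun t => discounted_abs_le hγ0 π P V hf t x)
  rwa [inv_mul_eq_div] at h

lemma policyExp_killedValue {γ : ℝ} (hγ0 : 0 ≤ γ) (hγ1 : γ < 1) (ρ : PMF S) (π : S → PMF A)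
    (P : S → A → PMF S) (V : Set (S × A)) {f : S × A → ℝ} {C : ℝ} (hf : ∀ x, |f x| ≤ C) :
    policyExp ρ π (killedValue π P V γ f)
      = ∑' t : ℕ, γ ^ t * policyExp ρ π ((killedStep π P V)^[t] f) := by
  simp only [← policyExp_const_mul]
  exact policyExp_tsum ρ π ((summable_geometric_of_lt_one hγ0 hγ1).mul_right C)
    (discounted_abs_le hγ0 π P V hf)

/-- The Bellman equation for the killed value. -/
lemma killedValue_eq {γ : ℝ} (hγ0 : 0 ≤ γ) (hγ1 : γ < 1) (π : S → PMF A)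
    (P : S → A → PMF S) (V : Set (S × A)) {f : S × A → ℝ} {C : ℝ} (hf : ∀ x, |f x| ≤ C)
    (x : S × A) :
    killedValue π P V γ f x = f x + γ * killedStep π P V (killedValue π P V γ f) x := by
  have hsum : Summable fun t : ℕ => γ ^ t * (killedStep π P V)^[t] f x :=
    Summable.of_norm_bounded ((summable_geometric_of_lt_one hγ0 hγ1).mul_right C)
      fun t => discounted_abs_le hγ0 π P V hf t x
  rw [killedValue, hsum.tsum_eq_zero_add, pow_zero, one_mul, Function.iterate_zero, id]
  congr 1
  simp only [Function.iterate_succ_apply', pow_succ']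
  simp only [mul_assoc, tsum_mul_left]
  congr 1
  by_cases hx : x ∈ Vᶜ
  · simp only [killedStep, Set.indicator_of_mem hx]
    exact (policyExp_killedValue hγ0 hγ1 (P x.1 x.2) π P V hf).symm
  · simp only [killedStep, Set.indicator_of_notMem hx, mul_zero, tsum_zero]

lemma pexp_pathPMF_succ (ρ : PMF S) (π : S → PMF A) (P : S → A → PMF S) (n : ℕ)
    {F : (Fin (n + 2) → S × A) → ℝ} {C : ℝ} (hF : ∀ p, |F p| ≤ C) :
    pexp (pathPMF ρ π P (n + 1)) F = pexp (pathPMF ρ π P n) fun p =>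
      policyExp (P (p (Fin.last n)).1 (p (Fin.last n)).2) π fun x =>
        F (Fin.snoc (α := fun _ => S × A) p x) := by
  rw [pathPMF, pexp_bind _ _ hF]
  congr 1
  funext p
  rw [pexp_bind _ _ hF, policyExp]
  congr 1
  funext s
  exact pexp_map _ _ hF

/-- Expectation of `f` at time `n` on the event that `V` is not visited before time `n`. -/
lemma pexp_pathPMF_killed (ρ : PMF S) (π : S → PMF A) (P : S → A → PMF S) (V : Set (S × A))
    (n : ℕ) {f : S × A → ℝ} {C : ℝ} (hf : ∀ x, |f x| ≤ C) :
    pexp (pathPMF ρ π P n)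
        ({p | ∀ i : Fin (n + 1), (i : ℕ) < n → p i ∉ V}.indicator fun p => f (p (Fin.last n)))
      = policyExp ρ π ((killedStep π P V)^[n] f) := by
  have hind : ∀ (m : ℕ) (B : Set (Fin (m + 1) → S × A)) (p : Fin (m + 1) → S × A),
      |B.indicator (fun p => f (p (Fin.last m))) p| ≤ C := by
    intro m B p
    by_cases hp : p ∈ B
    · rw [Set.indicator_of_mem hp]
      exact hf _
    · rw [Set.indicator_of_notMem hp, abs_zero]
      exact (abs_nonneg _).trans (hf (p 0))
  induction n generalizing f with
  | zero =>
    rw [pathPMF, pexp_bind _ _ (hind 0 _), Function.iterate_zero, id, policyExp]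
    congr 1
    funext s
    rw [pexp_map _ _ (hind 0 _)]
    simp
  | succ n ih =>
    rw [Function.iterate_succ_apply, ← ih (killedStep_abs_le π P V hf),
      pexp_pathPMF_succ ρ π P n (hind (n + 1) _)]
    · congr 1
      funext p
      have hiff : ∀ x : S × A,
          (∀ i : Fin (n + 2), (i : ℕ) < n + 1 → Fin.snoc (α := fun _ => S × A) p x i ∉ V) ↔
            (∀ i : Fin (n + 1), (i : ℕ) < n → p i ∉ V) ∧ p (Fin.last n) ∉ V := by
        intro x
        rw [Fin.forall_fin_succ']
        simp only [Fin.snoc_castSucc, Fin.val_castSucc, Fin.val_last, lt_irrefl,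
          IsEmpty.forall_iff, and_true]
        rw [Fin.forall_fin_succ', Fin.forall_fin_succ']
        simp
      simp only [Set.indicator, Set.mem_ofPred_eq, hiff]
      by_cases h₁ : ∀ i : Fin (n + 1), (i : ℕ) < n → p i ∉ V
      · by_cases h₂ : p (Fin.last n) ∈ V
        · simp [killedStep, h₂, policyExp_const]
        · simp only [killedStep, Set.indicator, Set.mem_compl_iff, h₂, not_false_eq_true, and_true,
            if_true, if_pos h₁, Fin.snoc_last]
      · simp only [h₁, false_and, if_false, policyExp_const]
    · intro m B p
      by_cases hp : p ∈ B
      · rw [Set.indicator_of_mem hp]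
        exact killedStep_abs_le π P V hf _
      · rw [Set.indicator_of_notMem hp, abs_zero]
        exact (abs_nonneg _).trans (hf (p 0))

lemma J_eq_policyExp {γ : ℝ} (hγ0 : 0 ≤ γ) (hγ1 : γ < 1) (ρ : PMF S) (π : S → PMF A)
    (P : S → A → PMF S) {r : S → A → ℝ} {C : ℝ} (hr : ∀ s a, |r s a| ≤ C) :
    J ρ π P γ r = policyExp ρ π (killedValue π P ∅ γ fun x => r x.1 x.2) := by
  have hf : ∀ x : S × A, |(fun x => r x.1 x.2) x| ≤ C := fun x => hr x.1 x.2
  rw [policyExp_killedValue hγ0 hγ1 ρ π P ∅ hf, J]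
  refine tsum_congr fun t => ?_
  rw [← pexp_pathPMF_killed ρ π P ∅ t hf, saDist, pexp_map _ _ hf]
  simp

lemma discHit_eq_policyExp {γ : ℝ} (hγ0 : 0 ≤ γ) (hγ1 : γ < 1) (ρ : PMF S) (π : S → PMF A)
    (P : S → A → PMF S) (V : Set (S × A)) :
    discHit ρ π P γ V = policyExp ρ π (killedValue π P V γ (V.indicator 1)) := by
  have hf : ∀ x : S × A, |V.indicator (1 : S × A → ℝ) x| ≤ 1 := fun x => by
    by_cases hx : x ∈ V <;> simp [hx]
  rw [policyExp_killedValue hγ0 hγ1 ρ π P V hf, discHit]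
  refine tsum_congr fun t => ?_
  rw [← pexp_pathPMF_killed ρ π P V t hf, hitProb, ← pexp_indicator_one]
  congr 2
  funext p
  simp only [Set.indicator, Set.mem_ofPred_eq, Pi.one_apply]
  split_ifs <;> tauto

end Bellman

section Pessimism

variable {S : Type*} {A : Type*}

/-- The state-action value of the pessimistic MDP, restricted to the non-halted states. -/
noncomputable def pessValue (Phat : S → A → PMF S) (U : Set (S × A)) (r : S → A → ℝ)
    (R γ : ℝ) (π : Option S → PMF A) (x : S × A) : ℝ :=
  killedValue π (pessKernel Phat U) ∅ γ (fun y => pessReward r R y.1 y.2) (some x.1, x.2)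

variable {Phat : S → A → PMF S} {U : Set (S × A)} {r : S → A → ℝ} {R γ : ℝ}

lemma nonneg_of_reward_bound (μ : PMF S) (π : S → PMF A) (hr : ∀ s a, |r s a| ≤ R) : 0 ≤ R :=
  (abs_nonneg _).trans
    (hr μ.support_nonempty.some (π μ.support_nonempty.some).support_nonempty.some)

lemma pessReward_abs_le (hR0 : 0 ≤ R) (hr : ∀ s a, |r s a| ≤ R) (y : Option S × A) :
    |pessReward r R y.1 y.2| ≤ R := by
  rcases y with ⟨_ | s, a⟩
  · simp [pessReward, abs_of_nonneg hR0]
  · exact hr s a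

lemma policyExp_map_some (ρ : PMF S) (π : Option S → PMF A) {f : Option S × A → ℝ} {C : ℝ}
    (hf : ∀ x, |f x| ≤ C) :
    policyExp (ρ.map some) π f
      = policyExp ρ (fun s => π (some s)) fun x => f (some x.1, x.2) := by
  rw [policyExp, pexp_map _ _ (fun s => pexp_abs_le _ fun a => hf (s, a)), policyExp]

lemma pessValue_abs_le (hγ0 : 0 ≤ γ) (hγ1 : γ < 1) (hR0 : 0 ≤ R) (hr : ∀ s a, |r s a| ≤ R)
    (π : Option S → PMF A) (x : S × A) : |pessValue Phat U r R γ π x| ≤ R / (1 - γ) :=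
  killedValue_abs_le hγ0 hγ1 π _ ∅ (pessReward_abs_le hR0 hr) _

lemma J_pess_eq (hγ0 : 0 ≤ γ) (hγ1 : γ < 1) (hR0 : 0 ≤ R) (hr : ∀ s a, |r s a| ≤ R)
    (ρ : PMF S) (π : Option S → PMF A) :
    J (ρ.map some) π (pessKernel Phat U) γ (pessReward r R)
      = policyExp ρ (fun s => π (some s)) (pessValue Phat U r R γ π) := by
  rw [J_eq_policyExp hγ0 hγ1 _ _ _ fun s a => pessReward_abs_le hR0 hr (s, a),
    policyExp_map_some _ _ (killedValue_abs_le hγ0 hγ1 π _ ∅ (pessReward_abs_le hR0 hr))]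
  rfl

lemma killedValue_pess_none (hγ0 : 0 ≤ γ) (hγ1 : γ < 1) (π : Option S → PMF A) (a : A) :
    killedValue π (pessKernel Phat U) ∅ γ (fun y => pessReward r R y.1 y.2) (none, a)
      = -R / (1 - γ) := by
  have hiter : ∀ (t : ℕ) (b : A), (killedStep π (pessKernel Phat U) ∅)^[t]
      (fun y => pessReward r R y.1 y.2) (none, b) = -R := by
    intro t
    induction t with
    | zero => exact fun b => rfl
    | succ t ih =>
      intro b
      rw [Function.iterate_succ_apply']
      simp only [killedStep, Set.compl_empty, Set.indicator_univ, policyExp, pessKernel,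
        pexp_pure, ih, pexp_const]
  simp only [killedValue, hiter, tsum_mul_right, tsum_geometric_of_lt_one hγ0 hγ1]
  rw [inv_mul_eq_div]

lemma pessValue_eq_of_mem (hγ0 : 0 ≤ γ) (hγ1 : γ < 1) (hR0 : 0 ≤ R)
    (hr : ∀ s a, |r s a| ≤ R) (π : Option S → PMF A) {x : S × A} (hx : x ∈ U) :
    pessValue Phat U r R γ π x = r x.1 x.2 + γ * (-R / (1 - γ)) := by
  rw [pessValue, killedValue_eq hγ0 hγ1 π _ ∅ (pessReward_abs_le hR0 hr)]
  simp only [killedStep, Set.compl_empty, Set.indicator_univ, policyExp, pessKernel, if_pos hx,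
    pexp_pure, killedValue_pess_none hγ0 hγ1, pexp_const]
  rfl

lemma pessValue_eq_of_notMem (hγ0 : 0 ≤ γ) (hγ1 : γ < 1) (hR0 : 0 ≤ R)
    (hr : ∀ s a, |r s a| ≤ R) (π : Option S → PMF A) {x : S × A} (hx : x ∉ U) :
    pessValue Phat U r R γ π x = r x.1 x.2
      + γ * policyExp (Phat x.1 x.2) (fun s => π (some s)) (pessValue Phat U r R γ π) := by
  rw [pessValue, killedValue_eq hγ0 hγ1 π _ ∅ (pessReward_abs_le hR0 hr)]
  simp only [killedStep, Set.compl_empty, Set.indicator_univ, pessKernel, if_neg hx]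
  rw [policyExp_map_some _ _ (killedValue_abs_le hγ0 hγ1 π _ ∅ (pessReward_abs_le hR0 hr))]
  rfl

lemma killedValue_empty_eq {C : ℝ} (hγ0 : 0 ≤ γ) (hγ1 : γ < 1) (π : S → PMF A)
    (P : S → A → PMF S) {f : S × A → ℝ} (hf : ∀ x, |f x| ≤ C) (x : S × A) :
    killedValue π P ∅ γ f x = f x
      + γ * policyExp (P x.1 x.2) π (killedValue π P ∅ γ f) := by
  rw [killedValue_eq hγ0 hγ1 π P ∅ hf]
  simp only [killedStep, Set.compl_empty, Set.indicator_univ]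

variable {P : S → A → PMF S} {α : ℝ}

lemma abs_policyExp_model_sub_le (hV : ∀ x ∉ U, DTV (Phat x.1 x.2) (P x.1 x.2) ≤ α)
    (hγ0 : 0 ≤ γ) (hγ1 : γ < 1) (hR0 : 0 ≤ R) (hr : ∀ s a, |r s a| ≤ R)
    (π : Option S → PMF A) {x : S × A} (hx : x ∉ U) :
    |policyExp (Phat x.1 x.2) (fun s => π (some s)) (pessValue Phat U r R γ π)
      - policyExp (P x.1 x.2) (fun s => π (some s)) (pessValue Phat U r R γ π)|
      ≤ 2 * (R / (1 - γ)) * α :=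
  (abs_policyExp_sub_le _ _ _ (pessValue_abs_le hγ0 hγ1 hR0 hr π)).trans
    (mul_le_mul_of_nonneg_left (hV x hx)
      (mul_nonneg two_pos.le (div_nonneg hR0 (by linarith))))

/-- Pessimism: up to the model error, the pessimistic value is a lower bound on the true
value. -/
lemma pessValue_le (hV : ∀ x ∉ U, DTV (Phat x.1 x.2) (P x.1 x.2) ≤ α) (hα : 0 ≤ α)
    (hγ0 : 0 ≤ γ) (hγ1 : γ < 1) (hR0 : 0 ≤ R) (hr : ∀ s a, |r s a| ≤ R)
    (π : Option S → PMF A) (x : S × A) :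
    pessValue Phat U r R γ π x
        - killedValue (fun s => π (some s)) P ∅ γ (fun y => r y.1 y.2) x
      ≤ γ * (2 * (R / (1 - γ)) * α) / (1 - γ) := by
  set π' : S → PMF A := fun s => π (some s) with hπ'
  set W := pessValue Phat U r R γ π with hW
  set Q := killedValue π' P ∅ γ (fun y => r y.1 y.2) with hQ
  have hR1 : 0 ≤ R / (1 - γ) := div_nonneg hR0 (by linarith)
  have hWb : ∀ y, |W y| ≤ R / (1 - γ) := pessValue_abs_le hγ0 hγ1 hR0 hr π
  have hQb : ∀ y, |Q y| ≤ R / (1 - γ) := killedValue_abs_le hγ0 hγ1 π' P ∅ fun y => hr y.1 y.2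
  have hDb : ∀ y, |W y - Q y| ≤ R / (1 - γ) + R / (1 - γ) := fun y =>
    (abs_sub _ _).trans (add_le_add (hWb y) (hQb y))
  have hc : 0 ≤ γ * (2 * (R / (1 - γ)) * α) := by positivity
  refine le_div_of_contraction hDb hγ0 hγ1 hc (fun m hm hDm y => ?_) x
  have hQy : Q y = r y.1 y.2 + γ * policyExp (P y.1 y.2) π' Q :=
    killedValue_empty_eq hγ0 hγ1 π' P (fun y => hr y.1 y.2) y
  by_cases hy : y ∈ U
  · have hWy : W y = r y.1 y.2 + γ * (-R / (1 - γ)) :=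
      pessValue_eq_of_mem hγ0 hγ1 hR0 hr π hy
    have hlow := (abs_le.1 (policyExp_abs_le (P y.1 y.2) π' hQb)).1
    rw [neg_div] at hWy
    have := mul_le_mul_of_nonneg_left hlow hγ0
    have := mul_nonneg hγ0 hm
    linarith
  · have hWy : W y = r y.1 y.2 + γ * policyExp (Phat y.1 y.2) π' W :=
      pessValue_eq_of_notMem hγ0 hγ1 hR0 hr π hy
    have hmodel := (abs_le.1 (abs_policyExp_model_sub_le hV hγ0 hγ1 hR0 hr π hy)).2
    have hstep := policyExp_le (P y.1 y.2) π' hDb hDm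
    rw [policyExp_sub _ _ hWb hQb] at hstep
    have h₁ := mul_le_mul_of_nonneg_left hmodel hγ0
    have h₂ := mul_le_mul_of_nonneg_left hstep hγ0
    simp only [← hπ', ← hW] at h₁
    linarith

/-- Up to the model error and the discounted hitting time of the unknown set, the
pessimistic value is an upper bound on the true value. -/
lemma le_pessValue (hV : ∀ x ∉ U, DTV (Phat x.1 x.2) (P x.1 x.2) ≤ α) (hα : 0 ≤ α)
    (hγ0 : 0 ≤ γ) (hγ1 : γ < 1) (hR0 : 0 ≤ R) (hr : ∀ s a, |r s a| ≤ R)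
    (π : Option S → PMF A) (x : S × A) :
    killedValue (fun s => π (some s)) P ∅ γ (fun y => r y.1 y.2) x
        - pessValue Phat U r R γ π x
        - 2 * (R / (1 - γ)) * killedValue (fun s => π (some s)) P U γ (U.indicator 1) x
      ≤ γ * (2 * (R / (1 - γ)) * α) / (1 - γ) := by
  set π' : S → PMF A := fun s => π (some s) with hπ'
  set W := pessValue Phat U r R γ π with hW
  set Q := killedValue π' P ∅ γ (fun y => r y.1 y.2) with hQ
  set H := killedValue π' P U γ (U.indicator 1) with hH
  have hR1 : 0 ≤ R / (1 - γ) := div_nonneg hR0 (by linarith)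
  have hWb : ∀ y, |W y| ≤ R / (1 - γ) := pessValue_abs_le hγ0 hγ1 hR0 hr π
  have hQb : ∀ y, |Q y| ≤ R / (1 - γ) := killedValue_abs_le hγ0 hγ1 π' P ∅ fun y => hr y.1 y.2
  have hone : ∀ y : S × A, |U.indicator (1 : S × A → ℝ) y| ≤ 1 := fun y => by
    by_cases hy : y ∈ U <;> simp [hy]
  have hHb : ∀ y, |2 * (R / (1 - γ)) * H y| ≤ 2 * (R / (1 - γ)) * (1 / (1 - γ)) := fun y => by
    rw [abs_mul, abs_of_nonneg (by positivity : 0 ≤ 2 * (R / (1 - γ)))]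
    exact mul_le_mul_of_nonneg_left (killedValue_abs_le hγ0 hγ1 π' P U hone y) (by positivity)
  have hQWb : ∀ y, |Q y - W y| ≤ R / (1 - γ) + R / (1 - γ) := fun y =>
    (abs_sub _ _).trans (add_le_add (hQb y) (hWb y))
  have hDb : ∀ y, |Q y - W y - 2 * (R / (1 - γ)) * H y|
      ≤ R / (1 - γ) + R / (1 - γ) + 2 * (R / (1 - γ)) * (1 / (1 - γ)) := fun y =>
    (abs_sub _ _).trans (add_le_add (hQWb y) (hHb y))
  have hc : 0 ≤ γ * (2 * (R / (1 - γ)) * α) := by positivity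
  refine le_div_of_contraction hDb hγ0 hγ1 hc (fun m hm hDm y => ?_) x
  have hHy : H y = U.indicator 1 y + γ * killedStep π' P U H y :=
    killedValue_eq hγ0 hγ1 π' P U hone y
  by_cases hy : y ∈ U
  · have hHy1 : H y = 1 := by
      rw [hHy, killedStep, Set.indicator_of_mem hy,
        Set.indicator_of_notMem (Set.notMem_compl_iff.2 hy), mul_zero, add_zero, Pi.one_apply]
    have := (abs_le.1 (hQWb y)).2
    have := mul_nonneg hγ0 hm
    rw [hHy1]
    linarith
  · have hHy' : H y = γ * policyExp (P y.1 y.2) π' H := by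
      rw [hHy, killedStep, Set.indicator_of_notMem hy, Set.indicator_of_mem hy, zero_add]
    have hQy : Q y = r y.1 y.2 + γ * policyExp (P y.1 y.2) π' Q :=
      killedValue_empty_eq hγ0 hγ1 π' P (fun y => hr y.1 y.2) y
    have hWy : W y = r y.1 y.2 + γ * policyExp (Phat y.1 y.2) π' W :=
      pessValue_eq_of_notMem hγ0 hγ1 hR0 hr π hy
    have hmodel := (abs_le.1 (abs_policyExp_model_sub_le hV hγ0 hγ1 hR0 hr π hy)).1
    have hstep := policyExp_le (P y.1 y.2) π' hDb hDm
    rw [policyExp_sub _ _ hQWb hHb, policyExp_sub _ _ hQb hWb, policyExp_const_mul] at hstep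
    have h₁ := mul_le_mul_of_nonneg_left hmodel hγ0
    have h₂ := mul_le_mul_of_nonneg_left hstep hγ0
    simp only [← hπ', ← hW] at h₁
    rw [hQy, hWy, hHy']
    linarith

lemma J_pess_le (hV : ∀ x ∉ U, DTV (Phat x.1 x.2) (P x.1 x.2) ≤ α) (hα : 0 ≤ α)
    (hγ0 : 0 ≤ γ) (hγ1 : γ < 1) (hr : ∀ s a, |r s a| ≤ R) (ρ0 ρhat : PMF S)
    (π : Option S → PMF A) :
    J (ρhat.map some) π (pessKernel Phat U) γ (pessReward r R)
      ≤ J ρ0 (fun s => π (some s)) P γ r + 2 * (R / (1 - γ)) * DTV ρ0 ρhat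
        + γ * (2 * (R / (1 - γ)) * α) / (1 - γ) := by
  have hR0 : 0 ≤ R := nonneg_of_reward_bound ρ0 (fun s => π (some s)) hr
  have hWb := pessValue_abs_le (Phat := Phat) (U := U) hγ0 hγ1 hR0 hr π
  have hQb := killedValue_abs_le hγ0 hγ1 (fun s => π (some s)) P ∅
    (f := fun y => r y.1 y.2) fun y => hr y.1 y.2
  rw [J_pess_eq hγ0 hγ1 hR0 hr, J_eq_policyExp hγ0 hγ1 _ _ _ hr]
  have hinit := (abs_le.1 (abs_policyExp_sub_le ρ0 ρhat (fun s => π (some s)) hWb)).1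
  have hval := policyExp_le ρ0 (fun s => π (some s))
    (fun y => (abs_sub _ _).trans (add_le_add (hWb y) (hQb y)))
    (pessValue_le hV hα hγ0 hγ1 hR0 hr π)
  rw [policyExp_sub _ _ hWb hQb] at hval
  linarith

lemma le_J_pess (hV : ∀ x ∉ U, DTV (Phat x.1 x.2) (P x.1 x.2) ≤ α) (hα : 0 ≤ α)
    (hγ0 : 0 ≤ γ) (hγ1 : γ < 1) (hr : ∀ s a, |r s a| ≤ R) (ρ0 ρhat : PMF S)
    (π : Option S → PMF A) :
    J ρ0 (fun s => π (some s)) P γ r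
      ≤ J (ρhat.map some) π (pessKernel Phat U) γ (pessReward r R)
        + 2 * (R / (1 - γ)) * DTV ρ0 ρhat + γ * (2 * (R / (1 - γ)) * α) / (1 - γ)
        + 2 * (R / (1 - γ)) * discHit ρ0 (fun s => π (some s)) P γ U := by
  have hR0 : 0 ≤ R := nonneg_of_reward_bound ρ0 (fun s => π (some s)) hr
  have hR1 : 0 ≤ 2 * (R / (1 - γ)) := mul_nonneg two_pos.le (div_nonneg hR0 (by linarith))
  have hWb := pessValue_abs_le (Phat := Phat) (U := U) hγ0 hγ1 hR0 hr π
  have hQb := killedValue_abs_le hγ0 hγ1 (fun s => π (some s)) P ∅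
    (f := fun y => r y.1 y.2) fun y => hr y.1 y.2
  have hone : ∀ y : S × A, |U.indicator (1 : S × A → ℝ) y| ≤ 1 := fun y => by
    by_cases hy : y ∈ U <;> simp [hy]
  have hHb : ∀ y, |2 * (R / (1 - γ)) *
      killedValue (fun s => π (some s)) P U γ (U.indicator 1) y|
        ≤ 2 * (R / (1 - γ)) * (1 / (1 - γ)) := fun y => by
    rw [abs_mul, abs_of_nonneg hR1]
    exact mul_le_mul_of_nonneg_left (killedValue_abs_le hγ0 hγ1 _ P U hone y) hR1
  have hQWb := fun y => (abs_sub _ _).trans (add_le_add (hQb y) (hWb y))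
  rw [J_pess_eq hγ0 hγ1 hR0 hr, J_eq_policyExp hγ0 hγ1 _ _ _ hr,
    discHit_eq_policyExp hγ0 hγ1]
  have hinit := (abs_le.1 (abs_policyExp_sub_le ρ0 ρhat (fun s => π (some s)) hWb)).2
  have hval := policyExp_le ρ0 (fun s => π (some s))
    (fun y => (abs_sub _ _).trans (add_le_add (hQWb y) (hHb y)))
    (le_pessValue hV hα hγ0 hγ1 hR0 hr π)
  rw [policyExp_sub _ _ hQWb hHb, policyExp_sub _ _ hQb hWb, policyExp_const_mul] at hval
  linarith

end Pessimism

/-- **Combined chain inequality from the proof of Lemma 1.** An `επ`-suboptimal policy for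
the `(α, Rmax)`-pessimistic MDP compares favourably in the true MDP against every policy
`π`, up to statistical, pessimism and hitting-time error terms. -/
theorem comparison_against_arbitrary_policy
    {S : Type u} {A : Type v} [Countable S] [Countable A]
    (P Phat : S → A → PMF S) (ρ0 ρhat : PMF S)
    (r : S → A → ℝ) (Rmax : ℝ) (hR : ∀ s a, |r s a| ≤ Rmax)
    (γ : ℝ) (hγ0 : 0 ≤ γ) (hγ1 : γ < 1)
    (α : ℝ) (hα : 0 ≤ α)
    (πout : Option S → PMF A) (επ : ℝ)
    (hsub : ∀ πe : Option S → PMF A,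
      J (ρhat.map some) πe (pessKernel Phat (unknown P Phat α)) γ (pessReward r Rmax)
        ≤ J (ρhat.map some) πout (pessKernel Phat (unknown P Phat α)) γ (pessReward r Rmax)
          + επ)
    (π : S → PMF A) :
    J ρ0 π P γ r - επ
        - (4 * Rmax / (1 - γ)) * DTV ρ0 ρhat
        - (4 * γ * Rmax / (1 - γ) ^ 2) * α
        - (2 * Rmax / (1 - γ)) * discHit ρ0 π P γ (unknown P Phat α)
      ≤ J ρ0 (fun s => πout (some s)) P γ r := by
  have hV : ∀ x ∉ unknown P Phat α, DTV (Phat x.1 x.2) (P x.1 x.2) ≤ α := fun x hx =>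
    not_lt.1 hx
  have hγ' : 1 - γ ≠ 0 := by linarith
  have hlow := le_J_pess hV hα hγ0 hγ1 hR ρ0 ρhat (extendPolicy π (πout none))
  have hupp := J_pess_le hV hα hγ0 hγ1 hR ρ0 ρhat πout
  have hopt := hsub (extendPolicy π (πout none))
  have hext : (fun s => extendPolicy π (πout none) (some s)) = π := rfl
  rw [hext] at hlow
  have hinit : 4 * Rmax / (1 - γ) = 2 * (2 * (Rmax / (1 - γ))) := by ring
  have hmodel : 4 * γ * Rmax / (1 - γ) ^ 2 * α
      = 2 * (γ * (2 * (Rmax / (1 - γ)) * α) / (1 - γ)) := by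
    field_simp
    ring
  have hhit : 2 * Rmax / (1 - γ) = 2 * (Rmax / (1 - γ)) := by ring
  rw [hinit, hmodel, hhit]
  linarith

end MOReL
end
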